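/- Let m, n ∈ ℕ and 0 < p ≤ q ≤ 2. Then for every unit vector θ in ℝ^n: |B_p^n(ℓ_q^m) ∩ H_diag| ≤ |B_p^n(ℓ_q^m) ∩ H_θ| ≤ |B_p^{n−1}(ℓ_q^m)|, where H_diag = {(x_1,…,x_n) ∈ (ℝ^m)^n : ∑_{i=1}^n x_i = 0}. -/

import Mathlib

open MeasureTheory Real Filter
open scoped ENNReal

noncomputable section

/-- `N` is a quasi-norm on `ℝ^m`. -/
def IsQuasiNorm (m : ℕ) (N : (Fin m → ℝ) → ℝ) : Prop :=
  (∀ x, 0 ≤ N x) ∧ (∀ x, N x = 0 ↔ x = 0) ∧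
    (∀ (a : ℝ) (x : Fin m → ℝ), N (a • x) = |a| * N x) ∧
    ∃ C : ℝ, 1 ≤ C ∧ ∀ x y, N (x + y) ≤ C * (N x + N y)

/-- `X = (ℝ^m, N)` admits an isometric embedding into some `L_p(μ)` space:
there are a measure space `(Ω, μ)` and a linear map `T : ℝ^m → L_p(μ)` with
`‖T x‖_{L_p(μ)} = N x` for every `x`. -/
def EmbedsIntoLp (m : ℕ) (p : ℝ) (N : (Fin m → ℝ) → ℝ) : Prop :=
  ∃ (Ω : Type) (_ : MeasurableSpace Ω) (μ : Measure Ω) (T : (Fin m → ℝ) →ₗ[ℝ] (Ω → ℝ)),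
    (∀ x, Integrable (fun ω => |T x ω| ^ p) μ) ∧
    ∀ x, (∫ ω, |T x ω| ^ p ∂μ) ^ (1 / p) = N x

/-- `α` is majorized by `β`: for every `k`, the sum of the `k` largest entries of `α` is at
most that of `β` (expressed via finite subsets: the sum of the `k` largest entries is the
maximum of `∑ i ∈ A, · i` over sets `A` of cardinality `k`), and the total sums agree. -/
def IsMajorizedBy {n : ℕ} (α β : Fin n → ℝ) : Prop :=
  (∀ A : Finset (Fin n), ∃ B : Finset (Fin n), B.card = A.card ∧ ∑ i ∈ A, α i ≤ ∑ i ∈ B, β i) ∧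
    ∑ i, α i = ∑ i, β i

/-- The unit ball `B_p^n(X)` of `ℓ_p^n(X)` for `X = (ℝ^m, N)` and `0 < p < ∞`. -/
def lpBall (m n : ℕ) (p : ℝ) (N : (Fin m → ℝ) → ℝ) : Set (Fin n × Fin m → ℝ) :=
  {x | ∑ i : Fin n, N (fun j => x (i, j)) ^ p ≤ 1}

/-- The block hyperplane `H_θ = {(x_1,…,x_n) ∈ (ℝ^m)^n : ∑ θ_i x_i = 0}`. -/
def blockHyp (m n : ℕ) (θ : Fin n → ℝ) : Set (Fin n × Fin m → ℝ) :=
  {x | ∀ j : Fin m, ∑ i : Fin n, θ i * x (i, j) = 0}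

/-- `ι` is a linear isometric parametrization (w.r.t. the Euclidean structures) of the
subspace `H` of `ℝ^{mn} = (ℝ^m)^n` by `ℝ^d`; for `A ⊆ H`, `volume (⇑ι ⁻¹' A)` is then the
`d`-dimensional Lebesgue measure of `A` inside `H`. -/
def IsEuclParam (m n d : ℕ) (ι : (Fin d → ℝ) →ₗ[ℝ] (Fin n × Fin m → ℝ))
    (H : Set (Fin n × Fin m → ℝ)) : Prop :=
  (∀ y, ∑ c, ι y c ^ 2 = ∑ i, y i ^ 2) ∧ Set.range ⇑ι = H

/-- The `ℓ_q` norm on `ℝ^m`, `0 < q < ∞`. -/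
def lqNorm (m : ℕ) (q : ℝ) (x : Fin m → ℝ) : ℝ := (∑ j, |x j| ^ q) ^ (1 / q)

section Mix

variable {κ : Type*} [Fintype κ]

/-- The class of bounded mixtures of centred Gaussians `x ↦ exp (-∑ u_c x_c ^ 2)` with diagonal
covariances: the smallest class of functions on `ℝ^κ` containing these Gaussians and closed
under sums, nonnegative multiples and uniformly bounded pointwise limits. -/
inductive DiagGaussMix : ((κ → ℝ) → ℝ) → Prop
  | gauss (u : κ → ℝ) (hu : ∀ c, 0 ≤ u c) :
      DiagGaussMix fun x => Real.exp (-∑ c, u c * x c ^ 2)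
  | add (f g : (κ → ℝ) → ℝ) : DiagGaussMix f → DiagGaussMix g → DiagGaussMix fun x => f x + g x
  | smul (c : ℝ) (hc : 0 ≤ c) (f : (κ → ℝ) → ℝ) : DiagGaussMix f → DiagGaussMix fun x => c * f x
  | lim (f : ℕ → (κ → ℝ) → ℝ) (g : (κ → ℝ) → ℝ) (M : ℝ) (hf : ∀ k, DiagGaussMix (f k))
      (hM : ∀ k x, f k x ≤ M) (h : ∀ x, Tendsto (fun k => f k x) atTop (nhds (g x))) :
      DiagGaussMix g

namespace DiagGaussMix

variable {f g : (κ → ℝ) → ℝ}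

lemma nonneg (hf : DiagGaussMix f) (x : κ → ℝ) : 0 ≤ f x := by
  induction hf with
  | gauss u hu => positivity
  | add f g _ _ hf hg => exact add_nonneg hf hg
  | smul c hc f _ hf => exact mul_nonneg hc hf
  | lim f g M _ _ h hf => exact ge_of_tendsto' (h x) hf

lemma exists_le (hf : DiagGaussMix f) : ∃ M, ∀ x, f x ≤ M := by
  induction hf with
  | gauss u hu =>
    refine ⟨1, fun x => Real.exp_le_one_iff.2 (neg_nonpos.2 ?_)⟩
    exact Finset.sum_nonneg fun c _ => mul_nonneg (hu c) (sq_nonneg _)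
  | add f g _ _ hf hg =>
    obtain ⟨M, hM⟩ := hf
    obtain ⟨M', hM'⟩ := hg
    exact ⟨M + M', fun x => add_le_add (hM x) (hM' x)⟩
  | smul c hc f _ hf =>
    obtain ⟨M, hM⟩ := hf
    exact ⟨c * M, fun x => mul_le_mul_of_nonneg_left (hM x) hc⟩
  | lim f g M _ hM h _ => exact ⟨M, fun x => le_of_tendsto' (h x) fun k => hM k x⟩

lemma measurable (hf : DiagGaussMix f) : Measurable f := by
  induction hf with
  | gauss u hu => fun_prop
  | add f g _ _ hf hg => exact hf.add hg
  | smul c hc f _ hf => exact hf.const_mul c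
  | lim f g M _ _ h hf => exact measurable_of_tendsto_metrizable hf (tendsto_pi_nhds.2 h)

lemma congr (hf : DiagGaussMix f) (h : ∀ x, f x = g x) : DiagGaussMix g :=
  (funext h : f = g) ▸ hf

lemma const {c : ℝ} (hc : 0 ≤ c) : DiagGaussMix fun _ : κ → ℝ => c :=
  (smul c hc _ (gauss (fun _ => 0) fun _ => le_rfl)).congr fun x => by simp

lemma mul (hf : DiagGaussMix f) (hg : DiagGaussMix g) : DiagGaussMix fun x => f x * g x := by
  induction hf with
  | gauss u hu =>
    induction hg with
    | gauss v hv =>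
      refine (gauss (u + v) fun c => add_nonneg (hu c) (hv c)).congr fun x => ?_
      rw [← Real.exp_add, ← neg_add, ← Finset.sum_add_distrib]
      simp only [Pi.add_apply, add_mul]
    | add f g _ _ hf hg => exact (add _ _ hf hg).congr fun x => by ring
    | smul c hc f _ hf => exact (smul c hc _ hf).congr fun x => by ring
    | lim f g M hf' hM h hf =>
      refine lim _ _ M hf (fun k x => ?_) fun x => (h x).const_mul _
      refine (mul_le_of_le_one_left ((hf' k).nonneg x) ?_).trans (hM k x)
      refine Real.exp_le_one_iff.2 (neg_nonpos.2 ?_)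
      exact Finset.sum_nonneg fun c _ => mul_nonneg (hu c) (sq_nonneg _)
  | add f g _ _ hf hg => exact (add _ _ hf hg).congr fun x => by ring
  | smul c hc f _ hf => exact (smul c hc _ hf).congr fun x => by ring
  | lim f f' M hf' hM h hf =>
    obtain ⟨M', hM'⟩ := hg.exists_le
    refine lim _ _ (M * M') hf (fun k x => ?_) fun x => (h x).mul_const _
    exact mul_le_mul (hM k x) (hM' x) (hg.nonneg x) (((hf' k).nonneg x).trans (hM k x))

lemma pow (hf : DiagGaussMix f) (k : ℕ) : DiagGaussMix fun x => f x ^ k := by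
  induction k with
  | zero => simpa using const zero_le_one
  | succ k ih => simpa only [pow_succ] using ih.mul hf

lemma sum {ι : Type*} (s : Finset ι) {F : ι → (κ → ℝ) → ℝ} (hF : ∀ i, DiagGaussMix (F i)) :
    DiagGaussMix fun x => ∑ i ∈ s, F i x := by
  classical
  induction s using Finset.induction_on with
  | empty => simpa using const le_rfl
  | insert a s ha ih => simpa only [Finset.sum_insert ha] using add _ _ (hF a) ih

lemma of_hasSum {F : ℕ → (κ → ℝ) → ℝ} (hF : ∀ k, DiagGaussMix (F k)) {M : ℝ}
    (hM : ∀ x, g x ≤ M) (h : ∀ x, HasSum (fun k => F k x) (g x)) : DiagGaussMix g :=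
  lim (fun N x => ∑ k ∈ Finset.range N, F k x) g M (fun _ => sum _ hF)
    (fun _ x => (sum_le_hasSum _ (fun k _ => (hF k).nonneg x) (h x)).trans (hM x))
    fun x => (h x).tendsto_sum_nat

lemma exp (hf : DiagGaussMix f) : DiagGaussMix fun x => Real.exp (f x) := by
  obtain ⟨M, hM⟩ := hf.exists_le
  refine of_hasSum (F := fun k x => ((k.factorial : ℝ))⁻¹ * f x ^ k)
    (fun k => smul _ (by positivity) _ (hf.pow k)) (fun x => Real.exp_le_exp.2 (hM x)) fun x => ?_
  have := NormedSpace.expSeries_div_hasSum_exp (f x)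
  rw [← Real.exp_eq_exp_ℝ] at this
  simpa only [div_eq_inv_mul] using this

lemma prod {ι : Type*} (s : Finset ι) {F : ι → (κ → ℝ) → ℝ} (hF : ∀ i, DiagGaussMix (F i)) :
    DiagGaussMix fun x => ∏ i ∈ s, F i x := by
  classical
  induction s using Finset.induction_on with
  | empty => simpa using const zero_le_one
  | insert a s ha ih => simpa only [Finset.prod_insert ha] using (hF a).mul ih

end DiagGaussMix

lemma neg_one_pow_mul_descPochhammer_nonneg {a : ℝ} (ha0 : 0 ≤ a) (ha1 : a ≤ 1) (k : ℕ) :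
    0 ≤ (-1) ^ k * (descPochhammer ℝ (k + 1)).eval a := by
  induction k with
  | zero => simpa using ha0
  | succ k ih =>
    rw [descPochhammer_succ_eval]
    have : 0 ≤ ((k + 1 : ℕ) : ℝ) - a := by push_cast; linarith [(Nat.cast_nonneg k : (0 : ℝ) ≤ k)]
    calc (0 : ℝ) ≤ _ := mul_nonneg ih this
      _ = _ := by ring

lemma hasSum_one_sub_one_sub_rpow {a t : ℝ} (ht0 : 0 ≤ t) (ht1 : t < 1) :
    HasSum (fun k : ℕ => (-1) ^ k * (descPochhammer ℝ (k + 1)).eval a / ((k + 1).factorial : ℝ)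
      * t ^ (k + 1)) (1 - (1 - t) ^ a) := by
  have h := (Real.one_add_rpow_hasFPowerSeriesOnBall_zero (a := a)).hasSum (y := -t)
    (by simp [enorm_eq_nnnorm, ← NNReal.coe_lt_coe, abs_of_nonneg ht0, ht1])
  rw [← hasSum_nat_add_iff' 1] at h
  have hc : ∀ j : ℕ, Ring.choose a j = (j.factorial : ℝ)⁻¹ * (descPochhammer ℝ j).eval a := by
    intro j
    rw [Ring.choose_eq_smul, ← Polynomial.aeval_eq_smeval, ← descPochhammer_map (Int.castRingHom ℝ),
      Polynomial.eval_map, Polynomial.aeval_def, smul_eq_mul]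
    rfl
  simp only [binomialSeries_apply, List.ofFn_const, List.prod_replicate, Finset.sum_range_one,
    hc] at h
  convert! h.neg using 1
  · ext k
    simp only [smul_eq_mul, neg_pow t]
    ring
  · simp [← sub_eq_add_neg]

namespace DiagGaussMix

/-- If `exp (-s ψ)` is a Gaussian mixture for all `s ≥ 0`, then so is `exp (-s ψ ^ a)` for
`0 < a ≤ 1`. -/
lemma exp_neg_rpow {ψ : (κ → ℝ) → ℝ} (h0 : ∀ x, 0 ≤ ψ x)
    (hψ : ∀ s : ℝ, 0 ≤ s → DiagGaussMix fun x => Real.exp (-(s * ψ x)))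
    {a : ℝ} (ha0 : 0 < a) (ha1 : a ≤ 1) {s : ℝ} (hs : 0 ≤ s) :
    DiagGaussMix fun x => Real.exp (-(s * ψ x ^ a)) := by
  have key : ∀ h : ℝ, 0 < h → DiagGaussMix fun x =>
      Real.exp (-(s * ((1 - Real.exp (-(h * (h + ψ x)))) / h) ^ a)) := by
    intro h hh
    have ht : DiagGaussMix fun x => Real.exp (-(h * (h + ψ x))) :=
      (smul (Real.exp (-(h * h))) (by positivity) _ (hψ h hh.le)).congr fun x => by
        rw [← Real.exp_add]; ring_nf
    have ht1 : ∀ x, Real.exp (-(h * (h + ψ x))) < 1 := fun x =>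
      Real.exp_lt_one_iff.2 (neg_neg_of_pos (mul_pos hh (add_pos_of_pos_of_nonneg hh (h0 x))))
    have hG : DiagGaussMix fun x => 1 - (1 - Real.exp (-(h * (h + ψ x)))) ^ a := by
      refine of_hasSum (fun k => smul _ ?_ _ (ht.pow (k + 1))) (M := 1) (fun x => ?_)
        fun x => hasSum_one_sub_one_sub_rpow (ht.nonneg x) (ht1 x)
      · exact div_nonneg (neg_one_pow_mul_descPochhammer_nonneg ha0.le ha1 k) (by positivity)
      · exact sub_le_self _ (Real.rpow_nonneg (sub_nonneg.2 (ht1 x).le) _)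
    refine (smul (Real.exp (-(s / h ^ a))) (by positivity) _
      (smul (s / h ^ a) (by positivity) _ hG).exp).congr fun x => ?_
    rw [← Real.exp_add, Real.div_rpow (sub_nonneg.2 (ht1 x).le) hh.le]
    ring_nf
  refine lim _ _ 1 (fun k : ℕ => key (1 / ((k : ℝ) + 1)) (by positivity)) (fun k x => ?_)
    fun x => ?_
  · refine Real.exp_le_one_iff.2 (neg_nonpos.2 (mul_nonneg hs (Real.rpow_nonneg ?_ _)))
    refine div_nonneg (sub_nonneg.2 (Real.exp_le_one_iff.2 (neg_nonpos.2 ?_))) (by positivity)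
    have := h0 x
    positivity
  · have hd : HasDerivAt (fun h : ℝ => Real.exp (-(h * (h + ψ x)))) (-ψ x) 0 := by
      have := ((hasDerivAt_id (0 : ℝ)).mul ((hasDerivAt_id (0 : ℝ)).add_const (ψ x))).neg.exp
      simpa using! this
    have hl := hd.tendsto_slope_zero_right.neg.comp
      (tendsto_nhdsWithin_iff.2 ⟨tendsto_one_div_add_atTop_nhds_zero_nat (𝕜 := ℝ),
        Eventually.of_forall fun k => Set.mem_Ioi.2 (by positivity)⟩)
    rw [neg_neg] at hl
    refine ((((hl.rpow_const (Or.inr ha0.le)).const_mul s).neg).rexp).congr fun k => ?_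
    simp only [Function.comp_apply, zero_add, zero_mul, neg_zero, Real.exp_zero, smul_eq_mul]
    rw [← mul_neg (_⁻¹), neg_sub, ← div_eq_inv_mul]

end DiagGaussMix

/-- `exp (-∑ ‖x_i‖_q ^ p)` is a mixture of diagonal Gaussians for `0 < p ≤ q ≤ 2`. -/
lemma diagGaussMix_exp_neg_lqNorm (m n : ℕ) {p q : ℝ} (hp0 : 0 < p) (hpq : p ≤ q) (hq2 : q ≤ 2) :
    DiagGaussMix fun x : Fin n × Fin m → ℝ =>
      Real.exp (-∑ i, lqNorm m q (fun j => x (i, j)) ^ p) := by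
  have hq0 := hp0.trans_le hpq
  have hcoord : ∀ c : Fin n × Fin m, ∀ s : ℝ, 0 ≤ s →
      DiagGaussMix fun x => Real.exp (-(s * |x c| ^ q)) := by
    intro c s hs
    refine (DiagGaussMix.exp_neg_rpow (ψ := fun x => x c ^ 2) (a := q / 2)
      (fun x => sq_nonneg _) (fun s hs => ?_) (by positivity) (by linarith) hs).congr fun x => ?_
    · refine (DiagGaussMix.gauss (Pi.single c s)
        fun b => by rw [Pi.single_apply]; split_ifs <;> simp [hs]).congr fun x => ?_
      rw [Finset.sum_eq_single c (fun b _ hb => by simp [hb]) (by simp)]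
      simp
    · rw [← sq_abs, ← Real.rpow_natCast, ← Real.rpow_mul (abs_nonneg _)]
      congr 4
      push_cast
      ring
  have hblock : ∀ i : Fin n, DiagGaussMix fun x : Fin n × Fin m → ℝ =>
      Real.exp (-lqNorm m q (fun j => x (i, j)) ^ p) := by
    intro i
    have h0 : ∀ x : Fin n × Fin m → ℝ, 0 ≤ ∑ j, |x (i, j)| ^ q := fun x =>
      Finset.sum_nonneg fun j _ => by positivity
    refine (DiagGaussMix.exp_neg_rpow (ψ := fun x => ∑ j, |x (i, j)| ^ q) (a := p / q) h0
      (fun s hs => ?_) (by positivity) ((div_le_one hq0).2 hpq) zero_le_one).congr fun x => ?_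
    · refine (DiagGaussMix.prod Finset.univ fun j => hcoord (i, j) s hs).congr fun x => ?_
      rw [← Real.exp_sum, Finset.sum_neg_distrib, Finset.mul_sum]
    · rw [lqNorm, ← Real.rpow_mul (h0 x), one_mul, one_div_mul_eq_div]
  refine (DiagGaussMix.prod Finset.univ hblock).congr fun x => ?_
  rw [← Real.exp_sum, Finset.sum_neg_distrib]

end Mix

section Sections

/-- A linear map preserving sums of squares between coordinate spaces of equal dimension
preserves Lebesgue measure. -/
lemma measurePreserving_of_sum_sq {A B : Type*} [Fintype A] [Fintype B]
    (hcard : Fintype.card A = Fintype.card B) (L : (A → ℝ) →ₗ[ℝ] (B → ℝ))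
    (hL : ∀ v, ∑ c, L v c ^ 2 = ∑ a, v a ^ 2) : MeasurePreserving L volume volume := by
  let L' : EuclideanSpace ℝ A →ₗᵢ[ℝ] EuclideanSpace ℝ B :=
    { toLinearMap := (WithLp.linearEquiv 2 ℝ (B → ℝ)).symm.toLinearMap ∘ₗ L ∘ₗ
        (WithLp.linearEquiv 2 ℝ (A → ℝ)).toLinearMap
      norm_map' := fun v => by
        simp only [EuclideanSpace.norm_eq, Real.norm_eq_abs, sq_abs]
        exact congrArg Real.sqrt (hL _) }
  have h := (L'.toLinearIsometryEquiv (by simpa using hcard)).measurePreserving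
  exact (PiLp.volume_preserving_ofLp B).comp (h.comp (PiLp.volume_preserving_toLp A))

variable {m n : ℕ} {D : Type*} [Fintype D]

/-- `ι` is a linear isometric parametrization of the block hyperplane `H_θ` by `ℝ^D`. -/
def IsSectionParam (θ : Fin n → ℝ) (ι : (D → ℝ) →ₗ[ℝ] (Fin n × Fin m → ℝ)) : Prop :=
  (∀ y, ∑ c, ι y c ^ 2 = ∑ i, y i ^ 2) ∧ Set.range ⇑ι = blockHyp m n θ

namespace IsSectionParam

variable {θ : Fin n → ℝ} {ι : (D → ℝ) →ₗ[ℝ] (Fin n × Fin m → ℝ)}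

lemma sum_mul_eq_zero (hι : IsSectionParam θ ι) (y : D → ℝ) (j : Fin m) :
    ∑ i, θ i * ι y (i, j) = 0 := by
  have h : ι y ∈ blockHyp m n θ := hι.2 ▸ Set.mem_range_self y
  exact h j

lemma measurePreserving_add (hι : IsSectionParam θ ι) (hθ : ∑ i, θ i ^ 2 = 1)
    (hD : Fintype.card D + m = n * m) :
    MeasurePreserving (fun v : (D → ℝ) × (Fin m → ℝ) =>
      ι v.1 + fun c : Fin n × Fin m => θ c.1 * v.2 c.2) volume volume := by
  let L : (D ⊕ Fin m → ℝ) →ₗ[ℝ] (Fin n × Fin m → ℝ) :=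
    ι ∘ₗ LinearMap.funLeft ℝ ℝ Sum.inl +
      LinearMap.pi fun c : Fin n × Fin m => θ c.1 • LinearMap.proj (Sum.inr c.2)
  have hL : MeasurePreserving L volume volume := by
    refine measurePreserving_of_sum_sq (by simpa using hD) L fun v => ?_
    have hv : ∀ c : Fin n × Fin m,
        L v c ^ 2 = ι (v ∘ Sum.inl) c ^ 2 + 2 * (v (Sum.inr c.2) * (θ c.1 * ι (v ∘ Sum.inl) c))
          + θ c.1 ^ 2 * v (Sum.inr c.2) ^ 2 := by
      intro c
      have : L v c = ι (v ∘ Sum.inl) c + θ c.1 * v (Sum.inr c.2) := rfl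
      rw [this]
      ring
    simp only [hv, Finset.sum_add_distrib, hι.1, ← Finset.mul_sum, Fintype.sum_sum_type]
    have h1 : ∑ c : Fin n × Fin m, v (Sum.inr c.2) * (θ c.1 * ι (v ∘ Sum.inl) c) = 0 := by
      simp only [Fintype.sum_prod_type_right, ← Finset.mul_sum, hι.sum_mul_eq_zero, mul_zero,
        Finset.sum_const_zero]
    have h2 : ∑ c : Fin n × Fin m, θ c.1 ^ 2 * v (Sum.inr c.2) ^ 2 = ∑ j, v (Sum.inr j) ^ 2 := by
      simp only [Fintype.sum_prod_type_right, ← Finset.sum_mul, hθ, one_mul]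
    simp [h1, h2]
  have h := hL.comp (volume_measurePreserving_sumPiEquivProdPi_symm fun _ : D ⊕ Fin m => ℝ)
  exact h

end IsSectionParam

lemma sum_sq_div_pos {θ : Fin n → ℝ} (hθ : ∑ i, θ i ^ 2 = 1) {w : Fin n → ℝ} (hw : ∀ i, 0 < w i) :
    0 < ∑ i, θ i ^ 2 / w i := by
  obtain ⟨i, hi⟩ : ∃ i, θ i ≠ 0 := by
    by_contra! h
    simp [h] at hθ
  have := hw i
  exact Finset.sum_pos' (fun i _ => div_nonneg (sq_nonneg _) (hw i).le)
    ⟨i, Finset.mem_univ _, by positivity⟩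

lemma exp_neg_sum_eq_prod {A : Type*} [Fintype A] (b : A → ℝ) (z : A → ℝ) :
    Real.exp (-∑ a, b a * z a ^ 2) = ∏ a, Real.exp (-b a * z a ^ 2) := by
  rw [← Real.exp_sum, ← Finset.sum_neg_distrib]
  simp only [neg_mul]

lemma integrable_exp_neg_sum {A : Type*} [Fintype A] {b : A → ℝ} (hb : ∀ a, 0 < b a) :
    Integrable fun z : A → ℝ => Real.exp (-∑ a, b a * z a ^ 2) := by
  simp only [exp_neg_sum_eq_prod]
  exact Integrable.fintype_prod fun a => integrable_exp_neg_mul_sq (hb a)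

lemma lintegral_exp_neg_sum {A : Type*} [Fintype A] {b : A → ℝ} (hb : ∀ a, 0 < b a) :
    ∫⁻ z : A → ℝ, ENNReal.ofReal (Real.exp (-∑ a, b a * z a ^ 2)) =
      ENNReal.ofReal (∏ a, √(π / b a)) := by
  rw [← ofReal_integral_eq_lintegral_ofReal (integrable_exp_neg_sum hb)
    (ae_of_all _ fun z => (Real.exp_pos _).le)]
  simp only [exp_neg_sum_eq_prod]
  rw [integral_fintype_prod_volume_eq_prod (fun a (x : ℝ) => Real.exp (-b a * x ^ 2))]
  simp only [integral_gaussian]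

/-- The integral of a diagonal Gaussian over `ℝ^{mn}` in terms of its integral over `H_θ`. -/
lemma lintegral_gauss_eq_mul {θ : Fin n → ℝ} {ι : (D → ℝ) →ₗ[ℝ] (Fin n × Fin m → ℝ)}
    (hι : IsSectionParam θ ι) (hθ : ∑ i, θ i ^ 2 = 1) (hD : Fintype.card D + m = n * m)
    {w : Fin n × Fin m → ℝ} (hw : ∀ c, 0 < w c) :
    ∫⁻ x : Fin n × Fin m → ℝ, ENNReal.ofReal (Real.exp (-∑ c, w c * x c ^ 2)) =
      (∫⁻ y, ENNReal.ofReal (Real.exp (-∑ c, w c * ι y c ^ 2))) *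
        ENNReal.ofReal (∏ j, √(π * ∑ i, θ i ^ 2 / w (i, j))) := by
  have hmeas : Measurable ι := ι.continuous_of_finiteDimensional.measurable
  set s : Fin m → ℝ := fun j => ∑ i, θ i ^ 2 / w (i, j) with hs
  have hs0 : ∀ j, 0 < s j := fun j => sum_sq_div_pos hθ fun i => hw (i, j)
  have hslice : ∀ z : Fin m → ℝ,
      ∫⁻ y, ENNReal.ofReal (Real.exp (-∑ c : Fin n × Fin m,
        w c * (ι y + fun c : Fin n × Fin m => θ c.1 * z c.2) c ^ 2)) =
      (∫⁻ y, ENNReal.ofReal (Real.exp (-∑ c, w c * ι y c ^ 2))) *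
        ENNReal.ofReal (Real.exp (-∑ j, (s j)⁻¹ * z j ^ 2)) := by
    intro z
    set V : Fin n × Fin m → ℝ := fun c => z c.2 / s c.2 * (θ c.1 / w c) with hV
    obtain ⟨y₀, hy₀⟩ : ((fun c => θ c.1 * z c.2) - V) ∈ Set.range ι := by
      rw [hι.2]
      intro j
      have h1 : ∀ i, θ i * (((fun c : Fin n × Fin m => θ c.1 * z c.2) - V) (i, j)) =
          θ i ^ 2 * z j - z j / s j * (θ i ^ 2 / w (i, j)) := by
        intro i
        simp only [Pi.sub_apply, hV]
        ring
      simp only [h1, Finset.sum_sub_distrib, ← Finset.sum_mul, ← Finset.mul_sum, hθ]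
      rw [one_mul, div_mul_cancel₀ _ (hs0 j).ne', sub_self]
    have hsplit : ∀ y, (ι y + fun c : Fin n × Fin m => θ c.1 * z c.2) = ι (y + y₀) + V := by
      intro y
      rw [map_add, hy₀]
      abel
    simp only [hsplit]
    rw [lintegral_add_right_eq_self (fun y => ENNReal.ofReal (Real.exp (-∑ c : Fin n × Fin m,
        w c * (ι y + V) c ^ 2))) y₀, ← lintegral_mul_const _ (by fun_prop)]
    refine lintegral_congr fun y => ?_
    rw [← ENNReal.ofReal_mul (Real.exp_pos _).le, ← Real.exp_add, ← neg_add]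
    congr 3
    have hexp : ∀ c : Fin n × Fin m, w c * (ι y + V) c ^ 2 =
        w c * ι y c ^ 2 + 2 * (z c.2 / s c.2 * (θ c.1 * ι y c)) +
          (z c.2 / s c.2) ^ 2 * (θ c.1 ^ 2 / w c) := by
      intro c
      have := (hw c).ne'
      simp only [Pi.add_apply, hV]
      field_simp
      ring
    simp only [hexp, Finset.sum_add_distrib, ← Finset.mul_sum]
    have h1 : ∑ c : Fin n × Fin m, z c.2 / s c.2 * (θ c.1 * ι y c) = 0 := by
      simp only [Fintype.sum_prod_type_right, ← Finset.mul_sum, hι.sum_mul_eq_zero, mul_zero,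
        Finset.sum_const_zero]
    have h2 : ∑ c : Fin n × Fin m, (z c.2 / s c.2) ^ 2 * (θ c.1 ^ 2 / w c) =
        ∑ j, (s j)⁻¹ * z j ^ 2 := by
      simp only [Fintype.sum_prod_type_right, ← Finset.mul_sum]
      refine Finset.sum_congr rfl fun j _ => ?_
      have := (hs0 j).ne'
      change (z j / s j) ^ 2 * s j = _
      field_simp
    rw [h1, h2]
    ring
  rw [← (hι.measurePreserving_add hθ hD).lintegral_comp (by fun_prop), Measure.volume_eq_prod,
    lintegral_prod_symm' _ (by fun_prop)]
  simp only [hslice]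
  rw [lintegral_const_mul _ (by fun_prop), lintegral_exp_neg_sum fun j => inv_pos.2 (hs0 j)]
  simp only [div_inv_eq_mul, hs]

lemma inv_prod_sqrt_le {J K : Type*} [Fintype J] [Fintype K] {l : K → ℝ} (hl : ∀ k, 0 ≤ l k)
    (hl1 : ∑ k, l k = 1) {s : K → J → ℝ} (hs : ∀ k j, 0 < s k j) :
    (∏ j, √(∑ k, l k * s k j))⁻¹ ≤ ∑ k, l k * (∏ j, √(s k j))⁻¹ := by
  have hexp : ∀ t : J → ℝ, (∀ j, 0 < t j) →
      (∏ j, √(t j))⁻¹ = Real.exp (-∑ j, Real.log (t j) / 2) := by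
    intro t ht
    rw [Real.exp_neg, Real.exp_sum]
    congr 1
    refine Finset.prod_congr rfl fun j _ => ?_
    rw [← Real.log_sqrt (ht j).le, Real.exp_log (Real.sqrt_pos.2 (ht j))]
  have hpos : ∀ j, 0 < ∑ k, l k * s k j := by
    intro j
    obtain ⟨k, hk⟩ : ∃ k, l k ≠ 0 := by
      by_contra! h
      simp [h] at hl1
    exact Finset.sum_pos' (fun k _ => mul_nonneg (hl k) (hs k j).le)
      ⟨k, Finset.mem_univ _, mul_pos ((hl k).lt_of_ne' hk) (hs k j)⟩
  rw [hexp _ hpos]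
  simp only [fun k => hexp (s k) (hs k)]
  have hlog : ∀ j, ∑ k, l k * Real.log (s k j) ≤ Real.log (∑ k, l k * s k j) := fun j => by
    simpa using strictConcaveOn_log_Ioi.concaveOn.le_map_sum (t := Finset.univ) (w := l)
      (p := fun k => s k j) (fun k _ => hl k) hl1 fun k _ => hs k j
  calc Real.exp (-∑ j, Real.log (∑ k, l k * s k j) / 2)
      ≤ Real.exp (∑ k, l k * -∑ j, Real.log (s k j) / 2) := by
        refine Real.exp_le_exp.2 ?_
        simp only [mul_neg, Finset.sum_neg_distrib, Finset.mul_sum]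
        rw [Finset.sum_comm]
        refine neg_le_neg (Finset.sum_le_sum fun j _ => ?_)
        simp only [← mul_div_assoc, ← Finset.sum_div]
        exact div_le_div_of_nonneg_right (hlog j) zero_le_two
    _ ≤ _ := by
        simpa using convexOn_exp.map_sum_le (t := Finset.univ) (w := l)
          (p := fun k => -∑ j, Real.log (s k j) / 2) (fun k _ => hl k) hl1 fun k _ => Set.mem_univ _

section Comparison

variable {E K : Type*} [Fintype E] [Fintype K] {θ : Fin n → ℝ} {Θ : K → Fin n → ℝ} {l : K → ℝ}
  {ι : (D → ℝ) →ₗ[ℝ] (Fin n × Fin m → ℝ)} {ιs : K → (E → ℝ) →ₗ[ℝ] (Fin n × Fin m → ℝ)}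

lemma lintegral_gauss_le (hι : IsSectionParam θ ι) (hιs : ∀ k, IsSectionParam (Θ k) (ιs k))
    (hθ : ∑ i, θ i ^ 2 = 1) (hΘ : ∀ k, ∑ i, Θ k i ^ 2 = 1)
    (hD : Fintype.card D + m = n * m) (hE : Fintype.card E + m = n * m)
    (hl : ∀ k, 0 ≤ l k) (hl1 : ∑ k, l k = 1) (hconv : ∀ i, θ i ^ 2 = ∑ k, l k * Θ k i ^ 2)
    {w : Fin n × Fin m → ℝ} (hw : ∀ c, 0 < w c) :
    ∫⁻ y, ENNReal.ofReal (Real.exp (-∑ c, w c * ι y c ^ 2)) ≤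
      ∑ k, ENNReal.ofReal (l k) *
        ∫⁻ y, ENNReal.ofReal (Real.exp (-∑ c, w c * ιs k y c ^ 2)) := by
  have hsolve : ∀ {I G : ℝ≥0∞} {r : ℝ}, 0 < r → G = I * ENNReal.ofReal r →
      I = G * ENNReal.ofReal r⁻¹ := by
    intro I G r hr h
    rw [h, mul_assoc, ← ENNReal.ofReal_mul hr.le, mul_inv_cancel₀ hr.ne', ENNReal.ofReal_one,
      mul_one]
  have hs0 : ∀ {θ : Fin n → ℝ}, ∑ i, θ i ^ 2 = 1 → ∀ j, 0 < π * ∑ i, θ i ^ 2 / w (i, j) :=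
    fun h j => mul_pos Real.pi_pos (sum_sq_div_pos h fun i => hw (i, j))
  have hp0 : ∀ {θ : Fin n → ℝ}, ∑ i, θ i ^ 2 = 1 → 0 < ∏ j, √(π * ∑ i, θ i ^ 2 / w (i, j)) :=
    fun h => Finset.prod_pos fun j _ => Real.sqrt_pos.2 (hs0 h j)
  rw [hsolve (hp0 hθ) (lintegral_gauss_eq_mul hι hθ hD hw)]
  simp only [fun k => hsolve (hp0 (hΘ k)) (lintegral_gauss_eq_mul (hιs k) (hΘ k) hE hw)]
  simp only [mul_left_comm (ENNReal.ofReal (l _)), ← Finset.mul_sum]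
  gcongr
  rw [Finset.sum_congr rfl fun k _ => (ENNReal.ofReal_mul (hl k)).symm,
    ← ENNReal.ofReal_sum_of_nonneg fun k _ => mul_nonneg (hl k) (inv_nonneg.2 (hp0 (hΘ k)).le)]
  refine ENNReal.ofReal_le_ofReal ((le_of_eq ?_).trans
    (inv_prod_sqrt_le hl hl1 fun k j => hs0 (hΘ k) j))
  congr 1
  refine Finset.prod_congr rfl fun j _ => ?_
  congr 1
  simp only [hconv, Finset.sum_div, Finset.mul_sum]
  rw [Finset.sum_comm]
  refine Finset.sum_congr rfl fun k _ => Finset.sum_congr rfl fun i _ => ?_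
  ring

lemma tendsto_lintegral_mul_gauss (hι : IsSectionParam θ ι) {f : ℕ → (Fin n × Fin m → ℝ) → ℝ}
    {g : (Fin n × Fin m → ℝ) → ℝ} {M : ℝ} (hf : ∀ k, DiagGaussMix (f k)) (hM : ∀ k x, f k x ≤ M)
    (h : ∀ x, Tendsto (fun k => f k x) atTop (nhds (g x))) {ε : ℝ} (hε : 0 < ε) :
    Tendsto (fun k => ∫⁻ y, ENNReal.ofReal (f k (ι y) * Real.exp (-∑ c, ε * ι y c ^ 2))) atTop
      (nhds (∫⁻ y, ENNReal.ofReal (g (ι y) * Real.exp (-∑ c, ε * ι y c ^ 2)))) := by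
  have hmeas : Measurable ι := ι.continuous_of_finiteDimensional.measurable
  refine tendsto_lintegral_of_dominated_convergence
    (fun y => ENNReal.ofReal (M * Real.exp (-∑ i, ε * y i ^ 2))) (fun k => ?_) (fun k => ?_) ?_ ?_
  · have := (hf k).measurable
    fun_prop
  · refine ae_of_all _ fun y => ENNReal.ofReal_le_ofReal ?_
    simp only [← Finset.mul_sum, hι.1]
    exact mul_le_mul_of_nonneg_right (hM k _) (Real.exp_pos _).le
  · exact ((integrable_exp_neg_sum fun _ => hε).const_mul M).lintegral_lt_top.ne
  · exact ae_of_all _ fun y => ENNReal.tendsto_ofReal ((h _).mul_const _)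

lemma lintegral_mul_gauss_le (hι : IsSectionParam θ ι) (hιs : ∀ k, IsSectionParam (Θ k) (ιs k))
    (hθ : ∑ i, θ i ^ 2 = 1) (hΘ : ∀ k, ∑ i, Θ k i ^ 2 = 1)
    (hD : Fintype.card D + m = n * m) (hE : Fintype.card E + m = n * m)
    (hl : ∀ k, 0 ≤ l k) (hl1 : ∑ k, l k = 1) (hconv : ∀ i, θ i ^ 2 = ∑ k, l k * Θ k i ^ 2)
    {F : (Fin n × Fin m → ℝ) → ℝ} (hF : DiagGaussMix F) {ε : ℝ} (hε : 0 < ε) :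
    ∫⁻ y, ENNReal.ofReal (F (ι y) * Real.exp (-∑ c, ε * ι y c ^ 2)) ≤
      ∑ k, ENNReal.ofReal (l k) *
        ∫⁻ y, ENNReal.ofReal (F (ιs k y) * Real.exp (-∑ c, ε * ιs k y c ^ 2)) := by
  have hmeas : Measurable ι := ι.continuous_of_finiteDimensional.measurable
  have hmeass : ∀ k, Measurable (ιs k) := fun k =>
    (ιs k).continuous_of_finiteDimensional.measurable
  induction hF with
  | gauss u hu =>
    have := lintegral_gauss_le hι hιs hθ hΘ hD hE hl hl1 hconv
      (w := fun c => u c + ε) fun c => add_pos_of_nonneg_of_pos (hu c) hε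
    simpa only [← Real.exp_add, ← neg_add, ← Finset.sum_add_distrib, ← add_mul] using this
  | add f g hf hg ihf ihg =>
    have hfm := hf.measurable
    have hgm := hg.measurable
    have hsplit : ∀ x (e : ℝ), 0 ≤ e → ENNReal.ofReal ((f x + g x) * e) =
        ENNReal.ofReal (f x * e) + ENNReal.ofReal (g x * e) := fun x e he => by
      rw [add_mul, ENNReal.ofReal_add (mul_nonneg (hf.nonneg x) he) (mul_nonneg (hg.nonneg x) he)]
    simp only [hsplit _ _ (Real.exp_pos _).le]
    rw [lintegral_add_left (by fun_prop)]
    simp only [fun k => lintegral_add_left (μ := volume)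
      (f := fun y => ENNReal.ofReal (f (ιs k y) * Real.exp (-∑ c, ε * ιs k y c ^ 2)))
      (by have := hmeass k; fun_prop), mul_add, Finset.sum_add_distrib]
    exact add_le_add ihf ihg
  | smul c hc f hf ih =>
    have hfm := hf.measurable
    simp only [mul_assoc c, ENNReal.ofReal_mul hc, lintegral_const_mul' _ _ ENNReal.ofReal_ne_top,
      mul_left_comm (ENNReal.ofReal (l _)), ← Finset.mul_sum]
    simp only [← Finset.mul_sum] at ih
    exact mul_le_mul_right ih _
  | lim f g M hf hM h ih =>
    exact le_of_tendsto_of_tendsto' (tendsto_lintegral_mul_gauss hι hf hM h hε)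
      (tendsto_finsetSum _ fun k _ => ENNReal.Tendsto.const_mul
        (tendsto_lintegral_mul_gauss (hιs k) hf hM h hε) (Or.inr ENNReal.ofReal_ne_top)) ih

/-- For a mixture `F` of diagonal Gaussians, the integral of `F` over `H_θ` is a convex function
of `(θ_1 ^ 2, …, θ_n ^ 2)`. -/
lemma lintegral_section_le (hι : IsSectionParam θ ι) (hιs : ∀ k, IsSectionParam (Θ k) (ιs k))
    (hθ : ∑ i, θ i ^ 2 = 1) (hΘ : ∀ k, ∑ i, Θ k i ^ 2 = 1)
    (hD : Fintype.card D + m = n * m) (hE : Fintype.card E + m = n * m)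
    (hl : ∀ k, 0 ≤ l k) (hl1 : ∑ k, l k = 1) (hconv : ∀ i, θ i ^ 2 = ∑ k, l k * Θ k i ^ 2)
    {F : (Fin n × Fin m → ℝ) → ℝ} (hF : DiagGaussMix F) :
    ∫⁻ y, ENNReal.ofReal (F (ι y)) ≤
      ∑ k, ENNReal.ofReal (l k) * ∫⁻ y, ENNReal.ofReal (F (ιs k y)) := by
  have hmeas : Measurable ι := ι.continuous_of_finiteDimensional.measurable
  have hFm := hF.measurable
  have hlim : Tendsto (fun N : ℕ => ∫⁻ y, ENNReal.ofReal (F (ι y) *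
      Real.exp (-∑ c, 1 / ((N : ℝ) + 1) * ι y c ^ 2))) atTop
      (nhds (∫⁻ y, ENNReal.ofReal (F (ι y)))) := by
    refine lintegral_tendsto_of_tendsto_of_monotone (fun N => by fun_prop) ?_ ?_
    · refine ae_of_all _ fun y N N' hN => ENNReal.ofReal_le_ofReal ?_
      refine mul_le_mul_of_nonneg_left (Real.exp_le_exp.2 (neg_le_neg ?_)) (hF.nonneg _)
      exact Finset.sum_le_sum fun c _ => mul_le_mul_of_nonneg_right
        (Nat.one_div_le_one_div hN) (sq_nonneg _)
    · refine ae_of_all _ fun y => ENNReal.tendsto_ofReal ?_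
      have h := ((tendsto_one_div_add_atTop_nhds_zero_nat (𝕜 := ℝ)).mul_const
        (∑ c, ι y c ^ 2)).neg.rexp.const_mul (F (ι y))
      simpa only [Finset.mul_sum, zero_mul, neg_zero, Real.exp_zero, mul_one,
        Finset.sum_const_zero] using h
  refine le_of_tendsto' hlim fun N => (lintegral_mul_gauss_le hι hιs hθ hΘ hD hE hl hl1 hconv hF
    Nat.one_div_pos_of_nat).trans ?_
  refine Finset.sum_le_sum fun k _ => mul_le_mul_right (lintegral_mono fun y =>
    ENNReal.ofReal_le_ofReal (mul_le_of_le_one_right (hF.nonneg _) ?_)) _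
  exact Real.exp_le_one_iff.2 (neg_nonpos.2 (Finset.sum_nonneg fun c _ => by positivity))

end Comparison

end Sections

section Volume

open scoped Pointwise in
/-- The volume of the unit ball of a function that is positively homogeneous of degree `p`. -/
lemma lintegral_exp_neg_eq_gamma_mul_volume {D : Type*} [Fintype D] {p : ℝ} (hp : 0 < p)
    {Ψ : (D → ℝ) → ℝ} (hm : Measurable Ψ) (h0 : ∀ y, 0 ≤ Ψ y)
    (hom : ∀ t : ℝ, 0 < t → ∀ y, Ψ (t • y) = t ^ p * Ψ y) :
    ∫⁻ y, ENNReal.ofReal (Real.exp (-Ψ y)) =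
      ENNReal.ofReal (Real.Gamma (Fintype.card D / p + 1)) * volume {y | Ψ y ≤ 1} := by
  have hlayer : ∀ y, ENNReal.ofReal (Real.exp (-Ψ y)) = ∫⁻ t in Set.Ioi (0 : ℝ),
      {x : (D → ℝ) × ℝ | Ψ x.1 ≤ x.2}.indicator
        (fun x => ENNReal.ofReal (Real.exp (-x.2))) (y, t) := by
    intro y
    have hind : ∀ t, {x : (D → ℝ) × ℝ | Ψ x.1 ≤ x.2}.indicator
        (fun x => ENNReal.ofReal (Real.exp (-x.2))) (y, t) =
        (Set.Ici (Ψ y)).indicator (fun t => ENNReal.ofReal (Real.exp (-t))) t := fun t => rfl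
    simp only [hind]
    rw [restrict_Ioi_eq_restrict_Ici, lintegral_indicator measurableSet_Ici,
      Measure.restrict_restrict measurableSet_Ici, Set.Ici_inter_Ici, sup_eq_left.2 (h0 y),
      ← restrict_Ioi_eq_restrict_Ici, ← integral_exp_neg_Ioi,
      ofReal_integral_eq_lintegral_ofReal (integrableOn_exp_neg_Ioi _)
        (ae_of_all _ fun t => (Real.exp_pos _).le)]
  have hscale : ∀ t : ℝ, 0 < t → volume {y | Ψ y ≤ t} =
      ENNReal.ofReal (t ^ (Fintype.card D / p)) * volume {y | Ψ y ≤ 1} := by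
    intro t ht
    have hr : 0 < t ^ (1 / p) := Real.rpow_pos_of_pos ht _
    have hset : {y | Ψ y ≤ t} = t ^ (1 / p) • {y | Ψ y ≤ 1} := by
      ext y
      rw [Set.mem_smul_set_iff_inv_smul_mem₀ hr.ne', Set.mem_ofPred_eq, Set.mem_ofPred_eq,
        hom _ (inv_pos.2 hr), Real.inv_rpow hr.le, ← Real.rpow_mul ht.le,
        one_div_mul_cancel hp.ne', Real.rpow_one, inv_mul_le_iff₀ ht, mul_one]
    rw [hset, Measure.addHaar_smul, Module.finrank_fintype_fun_eq_card, abs_of_pos (pow_pos hr _),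
      ← Real.rpow_natCast, ← Real.rpow_mul ht.le, one_div_mul_eq_div]
  have hmset : MeasurableSet {x : (D → ℝ) × ℝ | Ψ x.1 ≤ x.2} :=
    measurableSet_le (hm.comp measurable_fst) measurable_snd
  simp only [hlayer]
  rw [lintegral_lintegral_swap (f := fun y t => {x : (D → ℝ) × ℝ | Ψ x.1 ≤ x.2}.indicator
    (fun x => ENNReal.ofReal (Real.exp (-x.2))) (y, t))
    (Measurable.indicator (by fun_prop) hmset).aemeasurable]
  have hin : ∀ t ∈ Set.Ioi (0 : ℝ), ∫⁻ y, {x : (D → ℝ) × ℝ | Ψ x.1 ≤ x.2}.indicator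
        (fun x => ENNReal.ofReal (Real.exp (-x.2))) (y, t) =
      ENNReal.ofReal (Real.exp (-t) * t ^ ((Fintype.card D / p + 1) - 1)) *
        volume {y | Ψ y ≤ 1} := by
    intro t ht
    have hind : ∀ y, {x : (D → ℝ) × ℝ | Ψ x.1 ≤ x.2}.indicator
        (fun x => ENNReal.ofReal (Real.exp (-x.2))) (y, t) =
        {y | Ψ y ≤ t}.indicator (fun _ => ENNReal.ofReal (Real.exp (-t))) y := fun y => rfl
    simp only [hind]
    rw [lintegral_indicator_const (measurableSet_le hm measurable_const), hscale t ht,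
      ENNReal.ofReal_mul (Real.exp_pos _).le, add_sub_cancel_right, mul_assoc]
  rw [setLIntegral_congr_fun measurableSet_Ioi hin, lintegral_mul_const _ (by fun_prop),
    Real.Gamma_eq_integral (by positivity), ofReal_integral_eq_lintegral_ofReal
      (Real.GammaIntegral_convergent (by positivity))
      (ae_restrict_of_forall_mem measurableSet_Ioi fun t ht =>
        mul_nonneg (Real.exp_pos _).le (Real.rpow_nonneg (Set.mem_Ioi.1 ht).le _))]

variable {m n : ℕ} {p q : ℝ}

lemma measurable_lqNorm : Measurable (lqNorm m q) := by
  unfold lqNorm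
  fun_prop

lemma lqNorm_smul (hq : 0 < q) {t : ℝ} (ht : 0 < t) (x : Fin m → ℝ) :
    lqNorm m q (fun j => t * x j) = t * lqNorm m q x := by
  simp only [lqNorm, abs_mul, abs_of_pos ht, Real.mul_rpow ht.le (abs_nonneg _), ← Finset.mul_sum]
  rw [Real.mul_rpow (by positivity) (Finset.sum_nonneg fun j _ => by positivity),
    ← Real.rpow_mul ht.le, mul_one_div_cancel hq.ne', Real.rpow_one]

lemma lqNorm_nonneg (x : Fin m → ℝ) : 0 ≤ lqNorm m q x :=
  Real.rpow_nonneg (Finset.sum_nonneg fun j _ => by positivity) _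

lemma lqNorm_zero (hq : 0 < q) : lqNorm m q (fun _ => 0) = 0 := by
  simp [lqNorm, Real.zero_rpow hq.ne', hq.ne']

lemma lintegral_exp_neg_lqNorm_comp {D : Type*} [Fintype D] (hp : 0 < p) (hq : 0 < q)
    (L : (D → ℝ) →ₗ[ℝ] (Fin n × Fin m → ℝ)) :
    ∫⁻ y, ENNReal.ofReal (Real.exp (-∑ i, lqNorm m q (fun j => L y (i, j)) ^ p)) =
      ENNReal.ofReal (Real.Gamma (Fintype.card D / p + 1)) *
        volume (⇑L ⁻¹' lpBall m n p (lqNorm m q)) := by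
  have hL : Measurable L := L.continuous_of_finiteDimensional.measurable
  refine lintegral_exp_neg_eq_gamma_mul_volume hp
    (Finset.measurable_sum _ fun i _ => (measurable_lqNorm.comp (by fun_prop)).pow_const p)
    (fun y => Finset.sum_nonneg fun i _ => Real.rpow_nonneg (lqNorm_nonneg _) _) fun t ht y => ?_
  simp only [map_smul, Pi.smul_apply, smul_eq_mul, lqNorm_smul hq ht,
    Real.mul_rpow ht.le (lqNorm_nonneg _), Finset.mul_sum]

lemma volume_preimage_le_of_lintegral_le {D E : Type*} [Fintype D] [Fintype E] {n' : ℕ}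
    (hp : 0 < p) (hq : 0 < q) (hcard : Fintype.card D = Fintype.card E)
    (L : (D → ℝ) →ₗ[ℝ] (Fin n × Fin m → ℝ)) (L' : (E → ℝ) →ₗ[ℝ] (Fin n' × Fin m → ℝ))
    (h : ∫⁻ y, ENNReal.ofReal (Real.exp (-∑ i, lqNorm m q (fun j => L y (i, j)) ^ p)) ≤
      ∫⁻ y, ENNReal.ofReal (Real.exp (-∑ i, lqNorm m q (fun j => L' y (i, j)) ^ p))) :
    volume (⇑L ⁻¹' lpBall m n p (lqNorm m q)) ≤ volume (⇑L' ⁻¹' lpBall m n' p (lqNorm m q)) := by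
  rw [lintegral_exp_neg_lqNorm_comp hp hq, lintegral_exp_neg_lqNorm_comp hp hq, hcard] at h
  refine (ENNReal.mul_le_mul_iff_right ?_ ENNReal.ofReal_ne_top).1 h
  exact (ENNReal.ofReal_pos.2 (Real.Gamma_pos_of_pos (by positivity))).ne'

end Volume

section Params

variable {m k : ℕ}

/-- Inserting a zero block at position `i₀`. -/
def insertZeroBlock (m : ℕ) {k : ℕ} (i₀ : Fin (k + 1)) :
    (Fin k × Fin m → ℝ) →ₗ[ℝ] (Fin (k + 1) × Fin m → ℝ) where
  toFun y c := i₀.insertNth (α := fun _ => ℝ) 0 (fun i => y (i, c.2)) c.1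
  map_add' y z := by
    ext ⟨i, j⟩
    cases i using Fin.succAboveCases i₀ <;> simp
  map_smul' a y := by
    ext ⟨i, j⟩
    cases i using Fin.succAboveCases i₀ <;> simp

@[simp] lemma insertZeroBlock_self (i₀ : Fin (k + 1)) (y : Fin k × Fin m → ℝ) (j : Fin m) :
    insertZeroBlock m i₀ y (i₀, j) = 0 := by
  simp [insertZeroBlock]

@[simp] lemma insertZeroBlock_succAbove (i₀ : Fin (k + 1)) (y : Fin k × Fin m → ℝ) (i : Fin k)
    (j : Fin m) : insertZeroBlock m i₀ y (i₀.succAbove i, j) = y (i, j) := by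
  simp [insertZeroBlock]

lemma isSectionParam_insertZeroBlock (i₀ : Fin (k + 1)) :
    IsSectionParam (Pi.single i₀ 1) (insertZeroBlock m i₀) := by
  refine ⟨fun y => ?_, ?_⟩
  · simp [Fintype.sum_prod_type, Fin.sum_univ_succAbove _ i₀]
  · ext x
    constructor
    · rintro ⟨y, rfl⟩ j
      simp [Fin.sum_univ_succAbove _ i₀]
    · intro hx
      refine ⟨fun c => x (i₀.succAbove c.1, c.2), ?_⟩
      ext ⟨i, j⟩
      have := hx j
      cases i using Fin.succAboveCases i₀ <;> simp_all [Fin.sum_univ_succAbove _ i₀]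

/-- Composing a parametrization of `H_θ` with a permutation of the blocks. -/
lemma IsSectionParam.comp_perm {n : ℕ} {D : Type*} [Fintype D] {θ : Fin n → ℝ}
    {ι : (D → ℝ) →ₗ[ℝ] (Fin n × Fin m → ℝ)} (hι : IsSectionParam θ ι) (e : Equiv.Perm (Fin n)) :
    IsSectionParam (θ ∘ e) (LinearMap.funLeft ℝ ℝ (Prod.map e id) ∘ₗ ι) := by
  refine ⟨fun y => ?_, ?_⟩
  · rw [← hι.1 y]
    exact Equiv.sum_comp (Equiv.prodCongr e (Equiv.refl (Fin m))) fun c => ι y c ^ 2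
  · ext x
    constructor
    · rintro ⟨y, rfl⟩ j
      exact (Equiv.sum_comp e fun i => θ i * ι y (i, j)).trans (hι.sum_mul_eq_zero y j)
    · intro hx
      obtain ⟨y, hy⟩ : x ∘ Prod.map e.symm id ∈ Set.range ι := by
        rw [hι.2]
        intro j
        rw [← hx j, ← Equiv.sum_comp e]
        simp
      refine ⟨y, ?_⟩
      ext ⟨i, j⟩
      simp [LinearMap.funLeft_apply, hy]

end Params

/-- **Extremal sections of `B_p^n(ℓ_q^m)` for `0 < p ≤ q ≤ 2`.** For every unit vector `θ`
of `ℝ^n`, `|B_p^n(ℓ_q^m) ∩ H_diag| ≤ |B_p^n(ℓ_q^m) ∩ H_θ| ≤ |B_p^{n-1}(ℓ_q^m)|`, where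
`H_diag = H_{(1,…,1)}` and the `m(n-1)`-dimensional Lebesgue measures of the sections are
computed via Euclidean isometric parametrizations. -/
theorem sections_extremal_lq (m n : ℕ) (p q : ℝ) (hp0 : 0 < p) (hpq : p ≤ q) (hq2 : q ≤ 2)
    (θ : Fin n → ℝ) (hθ : ∑ i, θ i ^ 2 = 1)
    (ιθ ιd : (Fin (m * (n - 1)) → ℝ) →ₗ[ℝ] (Fin n × Fin m → ℝ))
    (hιθ : IsEuclParam m n (m * (n - 1)) ιθ (blockHyp m n θ))
    (hιd : IsEuclParam m n (m * (n - 1)) ιd (blockHyp m n (fun _ => 1))) :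
    volume (⇑ιd ⁻¹' (lpBall m n p (lqNorm m q) ∩ blockHyp m n (fun _ => 1))) ≤
        volume (⇑ιθ ⁻¹' (lpBall m n p (lqNorm m q) ∩ blockHyp m n θ)) ∧
      volume (⇑ιθ ⁻¹' (lpBall m n p (lqNorm m q) ∩ blockHyp m n θ)) ≤
        volume (lpBall m (n - 1) p (lqNorm m q)) := by
  have hq := hp0.trans_le hpq
  obtain ⟨k, rfl⟩ : ∃ k, n = k + 1 := Nat.exists_eq_succ_of_ne_zero (by rintro rfl; simp at hθ)
  have hD : Fintype.card (Fin (m * (k + 1 - 1))) + m = (k + 1) * m := by simp; ring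
  have hE : Fintype.card (Fin k × Fin m) + m = (k + 1) * m := by simp; ring
  have hF := diagGaussMix_exp_neg_lqNorm m (k + 1) hp0 hpq hq2
  have hsec : ∀ {θ : Fin (k + 1) → ℝ} {ι : (Fin (m * (k + 1 - 1)) → ℝ) →ₗ[ℝ] _},
      IsEuclParam m (k + 1) (m * (k + 1 - 1)) ι (blockHyp m (k + 1) θ) →
      ⇑ι ⁻¹' (lpBall m (k + 1) p (lqNorm m q) ∩ blockHyp m (k + 1) θ) =
        ⇑ι ⁻¹' lpBall m (k + 1) p (lqNorm m q) := by
    intro θ ι h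
    rw [Set.preimage_inter, ← h.2, Set.preimage_range, Set.inter_univ]
  rw [hsec hιθ, hsec hιd]
  have hιθ' : IsSectionParam θ ιθ := hιθ
  constructor
  · refine volume_preimage_le_of_lintegral_le hp0 hq rfl ιd ιθ ?_
    have hn : (0 : ℝ) < (k : ℝ) + 1 := by positivity
    have hιd' : IsSectionParam (fun _ => (√((k : ℝ) + 1))⁻¹) ιd := by
      refine ⟨hιd.1, hιd.2.trans ?_⟩
      ext x
      have : √((k : ℝ) + 1) ≠ 0 := (Real.sqrt_pos.2 hn).ne'
      simp [blockHyp, ← Finset.mul_sum, this]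
    have hle := lintegral_section_le (l := fun _ => ((k : ℝ) + 1)⁻¹) hιd'
      (fun a => hιθ'.comp_perm (Equiv.addRight a)) (by simp [hn.le, hn.ne'])
      (fun a => (Equiv.sum_comp (Equiv.addRight a) fun i => θ i ^ 2).trans hθ) hD hD
      (fun _ => by positivity) (by simp [hn.ne']) (fun i => ?_) hF
    · have hinv : ∀ (e : Equiv.Perm (Fin (k + 1))) (x : Fin (k + 1) × Fin m → ℝ),
          ∑ i, lqNorm m q (fun j => x (e i, j)) ^ p = ∑ i, lqNorm m q (fun j => x (i, j)) ^ p :=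
        fun e x => Equiv.sum_comp e fun i => lqNorm m q (fun j => x (i, j)) ^ p
      simp only [LinearMap.comp_apply, LinearMap.funLeft_apply, Prod.map_apply, id_eq, hinv,
        ← Finset.sum_mul] at hle
      rwa [← ENNReal.ofReal_sum_of_nonneg fun _ _ => by positivity, Finset.sum_const,
        Finset.card_univ, Fintype.card_fin, nsmul_eq_mul, Nat.cast_add, Nat.cast_one,
        mul_inv_cancel₀ hn.ne', ENNReal.ofReal_one, one_mul] at hle
    · rw [← Finset.mul_sum]
      have : ∑ a, (θ ∘ Equiv.addRight a) i ^ 2 = 1 :=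
        (Equiv.sum_comp (Equiv.addLeft i) fun i => θ i ^ 2).trans hθ
      rw [this, inv_pow, Real.sq_sqrt hn.le, mul_one]
  · refine volume_preimage_le_of_lintegral_le (n' := k) hp0 hq (by simp [mul_comm]) ιθ
      LinearMap.id ?_
    have hle := lintegral_section_le (l := fun i => θ i ^ 2) hιθ'
      (fun i => isSectionParam_insertZeroBlock i) hθ (fun a => by simp [Pi.single_apply]) hD hE
      (fun _ => sq_nonneg _) hθ (fun i => by simp [Pi.single_apply]) hF
    have hins : ∀ (i₀ : Fin (k + 1)) (y : Fin k × Fin m → ℝ),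
        ∑ i, lqNorm m q (fun j => insertZeroBlock m i₀ y (i, j)) ^ p =
          ∑ i, lqNorm m q (fun j => y (i, j)) ^ p := fun i₀ y => by
      simp [Fin.sum_univ_succAbove _ i₀, lqNorm_zero hq, Real.zero_rpow hp0.ne']
    simp only [hins, ← Finset.sum_mul] at hle
    rwa [← ENNReal.ofReal_sum_of_nonneg fun _ _ => sq_nonneg _, hθ, ENNReal.ofReal_one,
      one_mul] at hle
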